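/- Every 3-colorable finite simple graph admits a semi-transitive orientation. -/

import Mathlib

def IsOrientation {V : Type*} (G : SimpleGraph V) (R : V → V → Prop) : Prop :=
  (∀ x y : V, R x y → G.Adj x y) ∧ ∀ x y : V, G.Adj x y → (R x y ↔ ¬ R y x)

/-- A relation is semi-transitive if it is acyclic and, for every directed path
`v 0 → v 1 → ⋯ → v (k-1)` on `k ≥ 4` vertices, whenever the edge `v 0 → v (k-1)`
is present, all edges `v i → v j` for `i < j < k` are present (no shortcuts). -/
def IsSemiTransitive {V : Type*} (R : V → V → Prop) : Prop :=
  (∀ v : V, ¬ Relation.TransGen R v v) ∧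
  ∀ k : ℕ, 4 ≤ k → ∀ v : ℕ → V,
    (∀ i, i + 1 < k → R (v i) (v (i + 1))) →
    R (v 0) (v (k - 1)) →
    ∀ i j, i < j → j < k → R (v i) (v j)

theorem colorable_three_semiTransitive {V : Type*} [Fintype V] (G : SimpleGraph V)
    (h : G.Colorable 3) :
    ∃ R : V → V → Prop, IsOrientation G R ∧ IsSemiTransitive R := by
  obtain ⟨c⟩ := h
  refine ⟨fun x y => G.Adj x y ∧ c x < c y, ⟨fun x y h => h.1, ?_⟩, ?_, ?_⟩
  · intro x y hxy
    have hne : c x ≠ c y := c.valid hxy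
    constructor
    · rintro ⟨_, h1⟩ ⟨_, h2⟩
      exact lt_asymm h1 h2
    · intro hn
      refine ⟨hxy, lt_of_le_of_ne (not_lt.mp fun h2 => hn ⟨hxy.symm, h2⟩) hne⟩
  · -- colors strictly increase along directed paths
    have key : ∀ x y, Relation.TransGen (fun x y => G.Adj x y ∧ c x < c y) x y → c x < c y := by
      intro x y hxy
      induction hxy with
      | single h => exact h.2
      | tail _ h ih => exact ih.trans h.2
    intro v hv
    exact lt_irrefl _ (key v v hv)
  · -- a directed path on four vertices would need four colors
    intro k hk v hv _
    have h0 := (hv 0 (by omega)).2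
    have h1 := (hv 1 (by omega)).2
    have h2 := (hv 2 (by omega)).2
    have h3 := (c (v 3)).isLt
    simp only [Fin.lt_def, Nat.reduceAdd] at h0 h1 h2
    omega
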